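/- Let Q₁ and Q₂ be the quantile functions of two skew logistic distributions with parameters (γ₁, η₁, δ₁) and (γ₂, η₂, δ₂), where γ₁, γ₂ ∈ ℝ, η₁, η₂ > 0, δ₁, δ₂ ∈ [−1,1], and let μᵢ = γᵢ + ηᵢδᵢ denote their means. Then the squared L₂ Wasserstein distance has the closed form ∫₀¹ (Q₁(t) − Q₂(t))² dt = (μ₁ − μ₂)² + (η₁δ₁ − η₂δ₂)² + (π²/12)·[ (η₁ − η₂)² − (η₁δ₁ − η₂δ₂)² ], where the first summand is the mean component dM₁₂ = (μ₁ − μ₂)² and the remaining summands form the variability component dV₁₂ = (η₁δ₁ − η₂δ₂)² + (π²/12)·[ (η₁ − η₂)² − (η₁δ₁ − η₂δ₂)² ]. -/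

import Mathlib

open MeasureTheory

lemma aux_powlog_ii (n : ℕ) :
    IntervalIntegrable (fun t : ℝ => t^n * Real.log t) volume 0 1 :=
  intervalIntegral.intervalIntegrable_log'.continuousOn_mul (by fun_prop)

lemma aux_powlog (n : ℕ) :
    ∫ t in Set.Ioo (0:ℝ) 1, t^n * Real.log t = -1 / ((n:ℝ)+1)^2 := by
  have hn : (n:ℝ) + 1 ≠ 0 := by positivity
  rw [← integral_Ioc_eq_integral_Ioo, ← intervalIntegral.integral_of_le zero_le_one]
  rw [intervalIntegral.integral_eq_sub_of_hasDerivAt_of_le zero_le_one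
    (f := fun t : ℝ => t^n * (t * Real.log t) / (n+1) - t^(n+1) / (n+1)^2) ?_ ?_
    (aux_powlog_ii n)]
  · simp; ring
  · have := Real.continuous_mul_log
    apply Continuous.continuousOn
    fun_prop
  · intro t ht
    have ht0 : t ≠ 0 := ht.1.ne'
    have h1 : HasDerivAt (fun t : ℝ => t^(n+1) * Real.log t / (n+1) - t^(n+1) / (n+1)^2)
        ((((n+1:ℕ):ℝ) * t^n * Real.log t + t^(n+1) * t⁻¹) / (n+1) - ((n+1:ℕ):ℝ) * t^n / (n+1)^2) t :=
      (((hasDerivAt_pow (n+1) t).mul (Real.hasDerivAt_log ht0)).div_const _).sub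
        ((hasDerivAt_pow (n+1) t).div_const _)
    convert! h1 using 1
    · funext s; ring
    · push_cast; field_simp; ring

lemma aux_sq_deriv (t : ℝ) (ht : t ∈ Set.Ioo (0:ℝ) 1) :
    HasDerivAt (fun t : ℝ => t * Real.log t ^ 2 - 2 * (t * Real.log t) + 2 * t)
      (Real.log t ^ 2) t := by
  have ht0 : t ≠ 0 := ht.1.ne'
  have hl := Real.hasDerivAt_log ht0
  have h1 := (((hasDerivAt_id t).mul (hl.pow 2)).sub
    (((hasDerivAt_id t).mul hl).const_mul 2)).add ((hasDerivAt_id t).const_mul 2)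
  convert! h1 using 1
  simp; field_simp; ring

lemma aux_sq_cont :
    ContinuousOn (fun t : ℝ => t * Real.log t ^ 2 - 2 * (t * Real.log t) + 2 * t)
      (Set.Icc 0 1) := by
  have h := Real.continuous_mul_log
  have h2 : Continuous (fun t : ℝ => 4 * (√t * Real.log √t)^2 - 2 * (t * Real.log t) + 2 * t) := by
    have := h.comp Real.continuous_sqrt
    simp only [Function.comp_def] at this
    fun_prop
  refine h2.continuousOn.congr ?_
  intro t ht
  try simp only
  rw [mul_pow, Real.sq_sqrt ht.1, Real.log_sqrt ht.1]
  ring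

lemma aux_sq_int : IntegrableOn (fun t : ℝ => Real.log t ^ 2) (Set.Ioc 0 1) :=
  intervalIntegral.integrableOn_deriv_of_nonneg aux_sq_cont aux_sq_deriv
    (fun _ _ => sq_nonneg _)

lemma aux_sq_val : ∫ t in Set.Ioo (0:ℝ) 1, Real.log t ^ 2 = 2 := by
  rw [← integral_Ioc_eq_integral_Ioo, ← intervalIntegral.integral_of_le zero_le_one]
  rw [intervalIntegral.integral_eq_sub_of_hasDerivAt_of_le zero_le_one aux_sq_cont aux_sq_deriv
    ((intervalIntegrable_iff_integrableOn_Ioc_of_le zero_le_one).2 aux_sq_int)]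
  simp

lemma aux_refl (f : ℝ → ℝ) :
    ∫ t in Set.Ioo (0:ℝ) 1, f (1 - t) = ∫ t in Set.Ioo (0:ℝ) 1, f t := by
  rw [← integral_Ioc_eq_integral_Ioo, ← intervalIntegral.integral_of_le zero_le_one,
    ← integral_Ioc_eq_integral_Ioo, ← intervalIntegral.integral_of_le zero_le_one]
  simp

lemma aux_refl_int (f : ℝ → ℝ) (hf : IntegrableOn f (Set.Ioo 0 1)) :
    IntegrableOn (fun t => f (1 - t)) (Set.Ioo 0 1) := by
  rw [← intervalIntegrable_iff_integrableOn_Ioo_of_le zero_le_one] at hf ⊢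
  simpa using (hf.comp_sub_left 1).symm

lemma aux_hs : HasSum (fun n : ℕ => 1 / (((n:ℝ)+1) * ((n:ℝ)+2)^2)) (2 - Real.pi^2/6) := by
  have h1 : HasSum (fun n : ℕ => 1 / (((n:ℝ)+1) * ((n:ℝ)+2))) 1 := by
    rw [hasSum_iff_tendsto_nat_of_nonneg (fun n => by positivity)]
    have : ∀ n : ℕ, ∑ i ∈ Finset.range n, 1 / (((i:ℝ)+1) * ((i:ℝ)+2)) = 1 - 1 / ((n:ℝ)+1) := by
      intro n
      induction n with
      | zero => simp
      | succ k ih => rw [Finset.sum_range_succ, ih]; push_cast; field_simp; ring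
    simp_rw [this]
    simpa using (tendsto_one_div_add_atTop_nhds_zero_nat (𝕜 := ℝ)).const_sub 1
  have h2 := (hasSum_nat_add_iff' 2).2 hasSum_zeta_two
  have h3 := h1.sub h2
  convert! h3 using 1
  · funext n; push_cast; field_simp; ring
  · simp [Finset.sum_range_succ]; ring

lemma aux_cross :
    ∫ t in Set.Ioo (0:ℝ) 1, Real.log t * Real.log (1 - t) = 2 - Real.pi^2/6 := by
  have hI : ∀ n : ℕ, Integrable (fun t : ℝ => -(1/((n:ℝ)+1)) * (t^(n+1) * Real.log t))
      (volume.restrict (Set.Ioo 0 1)) := fun n =>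
    Integrable.const_mul
      ((intervalIntegrable_iff_integrableOn_Ioo_of_le zero_le_one).1 (aux_powlog_ii (n+1))) _
  have hv : ∀ n : ℕ, ∫ t in Set.Ioo (0:ℝ) 1, -(1/((n:ℝ)+1)) * (t^(n+1) * Real.log t)
      = 1 / (((n:ℝ)+1) * ((n:ℝ)+2)^2) := by
    intro n
    rw [integral_const_mul, aux_powlog]
    push_cast; field_simp; ring
  have hn : ∀ n : ℕ, ∫ t in Set.Ioo (0:ℝ) 1, ‖-(1/((n:ℝ)+1)) * (t^(n+1) * Real.log t)‖
      = 1 / (((n:ℝ)+1) * ((n:ℝ)+2)^2) := by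
    intro n
    rw [← hv n]
    refine setIntegral_congr_fun measurableSet_Ioo fun t ht => ?_
    try simp only
    rw [Real.norm_of_nonneg]
    have := Real.log_nonpos ht.1.le ht.2.le
    have h2 : 0 ≤ t^(n+1) := pow_nonneg ht.1.le _
    have h3 : t^(n+1) * Real.log t ≤ 0 := mul_nonpos_of_nonneg_of_nonpos h2 this
    have h4 : (0:ℝ) ≤ 1/((n:ℝ)+1) := by positivity
    nlinarith
  have key := hasSum_integral_of_summable_integral_norm hI (by simp_rw [hn]; exact aux_hs.summable)
  simp_rw [hv] at key
  rw [← key.unique aux_hs]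
  refine setIntegral_congr_fun measurableSet_Ioo fun t ht => ?_
  have h := (Real.hasSum_pow_div_log_of_abs_lt_one (x := t)
    (by rw [abs_of_pos ht.1]; exact ht.2)).mul_left (-Real.log t)
  have h' := h.tsum_eq
  try simp only
  rw [show Real.log t * Real.log (1-t) = -Real.log t * -Real.log (1-t) by ring, ← h']
  refine tsum_congr fun n => ?_
  ring

/-- Closed form of the squared `L₂` Wasserstein distance between two skew logistic
quantile functions, decomposed into the mean component and the variability
component. -/
theorem skew_logistic_wasserstein_closed_form
    (γ₁ η₁ δ₁ γ₂ η₂ δ₂ : ℝ)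
    (hη₁ : 0 < η₁) (hη₂ : 0 < η₂)
    (hδ₁ : δ₁ ∈ Set.Icc (-1:ℝ) 1) (hδ₂ : δ₂ ∈ Set.Icc (-1:ℝ) 1)
    (Q₁ Q₂ : ℝ → ℝ)
    (hQ₁ : ∀ t ∈ Set.Ioo (0:ℝ) 1,
      Q₁ t = γ₁ + η₁ * ((1-δ₁)/2 * Real.log t - (1+δ₁)/2 * Real.log (1-t)))
    (hQ₂ : ∀ t ∈ Set.Ioo (0:ℝ) 1,
      Q₂ t = γ₂ + η₂ * ((1-δ₂)/2 * Real.log t - (1+δ₂)/2 * Real.log (1-t)))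
    (μ₁ μ₂ : ℝ) (hμ₁ : μ₁ = γ₁ + η₁ * δ₁) (hμ₂ : μ₂ = γ₂ + η₂ * δ₂) :
    ∫ t in Set.Ioo (0:ℝ) 1, (Q₁ t - Q₂ t)^2
      = (μ₁ - μ₂)^2 + (η₁*δ₁ - η₂*δ₂)^2
        + Real.pi^2/12 * ((η₁ - η₂)^2 - (η₁*δ₁ - η₂*δ₂)^2) := by
  have hL : IntegrableOn Real.log (Set.Ioo 0 1) :=
    (intervalIntegrable_iff_integrableOn_Ioo_of_le zero_le_one).1
      intervalIntegral.intervalIntegrable_log'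
  have hM : IntegrableOn (fun t => Real.log (1 - t)) (Set.Ioo 0 1) := aux_refl_int _ hL
  have hL2 : IntegrableOn (fun t => Real.log t ^ 2) (Set.Ioo 0 1) :=
    aux_sq_int.mono_set Set.Ioo_subset_Ioc_self
  have hM2 : IntegrableOn (fun t => Real.log (1 - t) ^ 2) (Set.Ioo 0 1) := aux_refl_int _ hL2
  have hLM : IntegrableOn (fun t => Real.log t * Real.log (1 - t)) (Set.Ioo 0 1) :=
    MemLp.integrable_mul ((memLp_two_iff_integrable_sq hL.aestronglyMeasurable).2 hL2)
      ((memLp_two_iff_integrable_sq hM.aestronglyMeasurable).2 hM2)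
  have vL : ∫ t in Set.Ioo (0:ℝ) 1, Real.log t = -1 := by
    have := aux_powlog 0
    simpa using this
  have vM : ∫ t in Set.Ioo (0:ℝ) 1, Real.log (1 - t) = -1 := (aux_refl Real.log).trans vL
  have vM2 : ∫ t in Set.Ioo (0:ℝ) 1, Real.log (1 - t) ^ 2 = 2 :=
    (aux_refl (fun t => Real.log t ^ 2)).trans aux_sq_val
  obtain ⟨c, hc⟩ : ∃ c, c = γ₁ - γ₂ := ⟨_, rfl⟩
  obtain ⟨a, ha⟩ : ∃ a, a = η₁ * ((1-δ₁)/2) - η₂ * ((1-δ₂)/2) := ⟨_, rfl⟩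
  obtain ⟨b, hb⟩ : ∃ b, b = η₁ * ((1+δ₁)/2) - η₂ * ((1+δ₂)/2) := ⟨_, rfl⟩
  have hcongr : ∫ t in Set.Ioo (0:ℝ) 1, (Q₁ t - Q₂ t)^2
      = ∫ t in Set.Ioo (0:ℝ) 1, (c^2 + (2*c*a) * Real.log t + (-(2*c*b)) * Real.log (1-t)
        + a^2 * Real.log t ^ 2 + b^2 * Real.log (1-t) ^ 2
        + (-(2*a*b)) * (Real.log t * Real.log (1-t))) := by
    refine setIntegral_congr_fun measurableSet_Ioo fun t ht => ?_
    try simp only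
    rw [hQ₁ t ht, hQ₂ t ht, hc, ha, hb]
    ring
  have i0 : IntegrableOn (fun _ : ℝ => c^2) (Set.Ioo (0:ℝ) 1) := by simp
  have i1 := hL.const_mul (2*c*a)
  have i2 := hM.const_mul (-(2*c*b))
  have i3 := hL2.const_mul (a^2)
  have i4 := hM2.const_mul (b^2)
  have i5 := hLM.const_mul (-(2*a*b))
  have j1 := Integrable.fun_add i0 i1
  have j2 := Integrable.fun_add j1 i2
  have j3 := Integrable.fun_add j2 i3
  have j4 := Integrable.fun_add j3 i4
  rw [hcongr, integral_add j4 i5, integral_add j3 i4, integral_add j2 i3, integral_add j1 i2,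
    integral_add i0 i1]
  simp only [integral_const_mul, vL, vM, vM2, aux_sq_val, aux_cross]
  simp
  rw [hμ₁, hμ₂, hc, ha, hb]
  ring
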